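/- Conditional distribution on the sphere given the first n−2 coordinates: for n ≥ 3 and a fixed point (x₁, …, x_{n-2}) with x₁² + ⋯ + x_{n-2}² < 1, if (u, v) is uniformly distributed on the unit circle S¹ ⊂ ℝ² and ρ = √(1 − x₁² − ⋯ − x_{n-2}²), then the map sending (u,v) to (x₁, …, x_{n-2}, ρu, ρv) pushes the uniform measure on S¹ to the uniform measure on the circle {x ∈ S^{n-1} : xᵢ = xᵢ for i ≤ n−2}; consequently, if (Y₁, …, Y_{n-2}) is uniformly distributed on the unit ball of ℝ^{n-2} and (u, v) is an independent uniform point on S¹, then (Y₁, …, Y_{n-2}, u·√(1−‖Y‖²), v·√(1−‖Y‖²)) is uniformly distributed on the unit sphere S^{n-1} ⊂ ℝⁿ. -/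

import Mathlib

open MeasureTheory ProbabilityTheory Metric

/-- A measure is the uniform distribution on the unit sphere of a real inner product
space iff it is a (rotation-invariant) Borel probability measure concentrated on the
unit sphere that is invariant under every linear isometry. -/
def IsUniformSphere {E : Type*} [NormedAddCommGroup E] [InnerProductSpace ℝ E]
    [MeasurableSpace E] [BorelSpace E] (μ : Measure E) : Prop :=
  IsProbabilityMeasure μ ∧ μ (Metric.sphere (0 : E) 1)ᶜ = 0 ∧
    ∀ e : E ≃ₗᵢ[ℝ] E, μ.map e = μ

/-- The uniform distribution on the closed unit ball of `ℝⁿ`: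
normalized Lebesgue measure restricted to the ball. -/
noncomputable def uniformBall (n : ℕ) : Measure (EuclideanSpace ℝ (Fin n)) :=
  (volume (Metric.closedBall (0 : EuclideanSpace ℝ (Fin n)) 1))⁻¹ •
    volume.restrict (Metric.closedBall (0 : EuclideanSpace ℝ (Fin n)) 1)

open scoped ENNReal

namespace IsUniformSphere

variable {E : Type*} [NormedAddCommGroup E] [InnerProductSpace ℝ E] [MeasurableSpace E]
  [BorelSpace E] {F : Type*} [NormedAddCommGroup F] [InnerProductSpace ℝ F] [MeasurableSpace F]
  [BorelSpace F]

lemma ae_norm_eq_one {μ : Measure E} (hμ : IsUniformSphere μ) : ∀ᵐ w ∂μ, ‖w‖ = 1 := by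
  filter_upwards [measure_eq_zero_iff_ae_notMem.1 hμ.2.1] with w hw
  simpa using hw

lemma lintegral_comp {μ : Measure E} (hμ : IsUniformSphere μ) (e : E ≃ₗᵢ[ℝ] E) {f : E → ℝ≥0∞}
    (hf : Measurable f) : ∫⁻ w, f (e w) ∂μ = ∫⁻ w, f w ∂μ := by
  conv_rhs => rw [← hμ.2.2 e]
  rw [lintegral_map hf e.continuous.measurable]

lemma map {μ : Measure E} (hμ : IsUniformSphere μ) (φ : E ≃ₗᵢ[ℝ] F) :
    IsUniformSphere (μ.map φ) := by
  have hφ : Measurable φ := φ.continuous.measurable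
  have := hμ.1
  refine ⟨Measure.isProbabilityMeasure_map hφ.aemeasurable, ?_, fun e ↦ ?_⟩
  · rw [Measure.map_apply hφ isClosed_sphere.measurableSet.compl]
    convert hμ.2.1 using 2
    ext x
    simp
  · rw [Measure.map_map e.continuous.measurable hφ]
    conv_rhs => rw [← hμ.2.2 ((φ.trans e).trans φ.symm)]
    rw [Measure.map_map hφ (LinearIsometryEquiv.continuous _).measurable]
    congr 1
    ext x
    simp

end IsUniformSphere

/-- Averaging a function on the plane over circles, with respect to any rotation-invariant
probability measure on the unit circle, does not change its integral. -/
lemma IsUniformSphere.lintegral_lintegral_norm_smul {κ : Measure ℂ} (hκ : IsUniformSphere κ)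
    {f : ℂ → ℝ≥0∞} (hf : Measurable f) :
    ∫⁻ z : ℂ, ∫⁻ w, f (‖z‖ • w) ∂κ = ∫⁻ z, f z := by
  have := hκ.1
  calc ∫⁻ z : ℂ, ∫⁻ w, f (‖z‖ • w) ∂κ
      = ∫⁻ z : ℂ, ∫⁻ w, f (z * w) ∂κ := by
        refine lintegral_congr fun z ↦ ?_
        obtain rfl | hz := eq_or_ne z 0
        · simp
        let c : Circle := ⟨z / ‖z‖, by simp [Submonoid.unitSphere, hz]⟩
        have hz' : (‖z‖ : ℂ) ≠ 0 := by simpa using hz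
        rw [← hκ.lintegral_comp (rotation c) (f := fun w ↦ f (‖z‖ • w)) (by fun_prop)]
        refine lintegral_congr fun w ↦ ?_
        have hc : (c : ℂ) = z / ‖z‖ := rfl
        rw [rotation_apply, Complex.real_smul, hc, ← mul_assoc, mul_div_cancel₀ _ hz']
    _ = ∫⁻ w, (∫⁻ z : ℂ, f (z * w)) ∂κ := by
        apply lintegral_lintegral_swap
        exact (hf.comp (measurable_fst.mul measurable_snd)).aemeasurable
    _ = ∫⁻ _, (∫⁻ z, f z) ∂κ := by
        refine lintegral_congr_ae ?_
        filter_upwards [hκ.ae_norm_eq_one] with w hw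
        let c : Circle := ⟨w, by simp [Submonoid.unitSphere, hw]⟩
        rw [← (rotation c).measurePreserving.lintegral_comp hf]
        have hc : (c : ℂ) = w := rfl
        simp only [rotation_apply, hc, mul_comm]
    _ = ∫⁻ z, f z := by simp

lemma Complex.lintegral_fun_norm_sq (g : ℝ → ℝ≥0∞) (hg : Measurable g) :
    ∫⁻ z : ℂ, g (‖z‖ ^ 2) = ENNReal.ofReal Real.pi * ∫⁻ s in Set.Ici 0, g s := by
  have himg : (fun r : ℝ ↦ r ^ 2) '' Set.Ioi 0 = Set.Ioi 0 := by
    ext s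
    constructor
    · rintro ⟨r, hr, rfl⟩
      exact pow_pos (Set.mem_Ioi.1 hr) 2
    · intro hs
      exact ⟨√s, Real.sqrt_pos.2 hs, Real.sq_sqrt (le_of_lt hs)⟩
  have hsub : ∫⁻ s in Set.Ici 0, g s =
      ∫⁻ r in Set.Ioi (0 : ℝ), ENNReal.ofReal (2 * r) * g (r ^ 2) := by
    rw [← restrict_Ioi_eq_restrict_Ici]
    conv_lhs => rw [← himg]
    rw [lintegral_image_eq_lintegral_abs_deriv_mul measurableSet_Ioi
      (f' := fun r ↦ 2 * r) (fun r _ ↦ by simpa using (hasDerivAt_pow 2 r).hasDerivWithinAt)]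
    · refine setLIntegral_congr_fun measurableSet_Ioi fun r hr ↦ ?_
      rw [abs_of_pos (mul_pos two_pos hr)]
    · intro a ha b hb hab
      exact (pow_left_inj₀ (le_of_lt ha) (le_of_lt hb) two_ne_zero).1 hab
  rw [hsub, ← Complex.lintegral_comp_polarCoord_symm, polarCoord_target,
    Measure.volume_eq_prod, ← Measure.prod_restrict, lintegral_prod]
  · rw [← lintegral_const_mul _ (by fun_prop)]
    refine setLIntegral_congr_fun measurableSet_Ioi fun r hr ↦ ?_
    have hr : 0 < r := hr
    simp only [Complex.norm_polarCoord_symm, sq_abs, smul_eq_mul, lintegral_const,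
      Measure.restrict_apply MeasurableSet.univ, Set.univ_inter, Real.volume_Ioo]
    rw [ENNReal.ofReal_mul two_pos.le, sub_neg_eq_add, ← two_mul, ENNReal.ofReal_mul two_pos.le]
    ring
  · simp only [Complex.norm_polarCoord_symm, sq_abs, smul_eq_mul]
    fun_prop

/-- Polar coordinates in the plane, with the squared radius as radial coordinate and any
rotation-invariant probability measure on the circle as angular measure. -/
lemma IsUniformSphere.lintegral_eq_lintegral_sqrt_smul {κ : Measure (EuclideanSpace ℝ (Fin 2))}
    (hκ : IsUniformSphere κ) {f : EuclideanSpace ℝ (Fin 2) → ℝ≥0∞} (hf : Measurable f) :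
    ∫⁻ z, f z = ENNReal.ofReal Real.pi * ∫⁻ s in Set.Ici 0, ∫⁻ w, f (√s • w) ∂κ := by
  have := hκ.1
  let φ := Complex.orthonormalBasisOneI.repr
  have hφ : Measurable φ := φ.continuous.measurable
  have hφ' : Measurable φ.symm := φ.symm.continuous.measurable
  have hm : Measurable fun s : ℝ ↦ ∫⁻ w, f (√s • w) ∂κ :=
    Measurable.lintegral_prod_right' (f := fun p : ℝ × _ ↦ f (√p.1 • p.2)) (by fun_prop)
  rw [← Complex.lintegral_fun_norm_sq _ hm, ← φ.measurePreserving.lintegral_comp hf,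
    ← (hκ.map φ.symm).lintegral_lintegral_norm_smul (f := fun z ↦ f (φ z)) (by fun_prop)]
  refine lintegral_congr fun z ↦ ?_
  rw [lintegral_map (by fun_prop) hφ']
  simp_rw [Real.sqrt_sq (norm_nonneg z), map_smul, φ.apply_symm_apply]

/-- Integration over the solid region `{(y, s) | ‖y‖ ^ 2 + s ≤ 1}`, sliced by the value of
`‖y‖ ^ 2 + s`: each slice is a rescaled copy of the unit ball. -/
lemma lintegral_lintegral_indicator_Ioc_norm_sq_add {V : Type*} [NormedAddCommGroup V]
    [InnerProductSpace ℝ V] [FiniteDimensional ℝ V] [MeasurableSpace V] [BorelSpace V]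
    {ψ : V → ℝ≥0∞} (hψ : Measurable ψ) :
    ∫⁻ y : V, ∫⁻ s in Set.Ici (0 : ℝ), (Set.Ioc (0 : ℝ) 1).indicator
        (fun t ↦ ψ ((√t)⁻¹ • y)) (‖y‖ ^ 2 + s) =
      (∫⁻ t in Set.Ioc (0 : ℝ) 1, ENNReal.ofReal (√t ^ Module.finrank ℝ V)) *
        ∫⁻ y in closedBall (0 : V) 1, ψ y := by
  have hmI : Measurable fun p : V × ℝ ↦ ({q | ‖q.1‖ ^ 2 ≤ q.2} : Set (V × ℝ)).indicator
      (fun q ↦ ψ ((√q.2)⁻¹ • q.1)) p :=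
    Measurable.indicator (by fun_prop) (measurableSet_le (by fun_prop) (by fun_prop))
  calc ∫⁻ y : V, ∫⁻ s in Set.Ici (0 : ℝ), (Set.Ioc (0 : ℝ) 1).indicator
        (fun t ↦ ψ ((√t)⁻¹ • y)) (‖y‖ ^ 2 + s)
      = ∫⁻ y : V, ∫⁻ t in Set.Ioc (0 : ℝ) 1, ({q | ‖q.1‖ ^ 2 ≤ q.2} : Set (V × ℝ)).indicator
          (fun q ↦ ψ ((√q.2)⁻¹ • q.1)) (y, t) := by
        refine lintegral_congr fun y ↦ ?_
        rw [← lintegral_indicator measurableSet_Ici, ← lintegral_indicator measurableSet_Ioc,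
          ← lintegral_add_left_eq_self (Set.indicator (Set.Ioc (0 : ℝ) 1) _) (‖y‖ ^ 2)]
        refine lintegral_congr fun s ↦ ?_
        by_cases hs : 0 ≤ s <;> by_cases ht : ‖y‖ ^ 2 + s ∈ Set.Ioc (0 : ℝ) 1 <;>
          simp only [Set.indicator, Set.mem_Ici, Set.mem_ofPred_eq, le_add_iff_nonneg_right, hs, ht,
            if_true, if_false]
    _ = ∫⁻ t in Set.Ioc (0 : ℝ) 1, ∫⁻ y : V, ({q | ‖q.1‖ ^ 2 ≤ q.2} : Set (V × ℝ)).indicator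
          (fun q ↦ ψ ((√q.2)⁻¹ • q.1)) (y, t) :=
        lintegral_lintegral_swap hmI.aemeasurable
    _ = ∫⁻ t in Set.Ioc (0 : ℝ) 1, ENNReal.ofReal (√t ^ Module.finrank ℝ V) *
          ∫⁻ y in closedBall (0 : V) 1, ψ y := by
        refine setLIntegral_congr_fun measurableSet_Ioc fun t ht ↦ ?_
        have hr : 0 < √t := Real.sqrt_pos.2 ht.1
        rw [← lintegral_indicator isClosed_closedBall.measurableSet, ← smul_eq_mul,
          ← lintegral_smul_measure]
        have hmap := Measure.map_addHaar_smul (volume : Measure V) (inv_ne_zero hr.ne')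
        rw [inv_pow, inv_inv, abs_of_pos (pow_pos hr _)] at hmap
        rw [← hmap, lintegral_map (hψ.indicator isClosed_closedBall.measurableSet) (by fun_prop)]
        refine lintegral_congr fun y ↦ ?_
        have hiff : ‖y‖ ^ 2 ≤ t ↔ (√t)⁻¹ • y ∈ closedBall (0 : V) 1 := by
          rw [mem_closedBall_zero_iff, norm_smul, norm_inv, Real.norm_of_nonneg hr.le,
            inv_mul_le_one₀ hr, Real.le_sqrt (norm_nonneg y) ht.1.le]
        by_cases hy : ‖y‖ ^ 2 ≤ t <;>
          simp only [Set.indicator, Set.mem_ofPred_eq, ← hiff, hy, if_true, if_false]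
    _ = _ := lintegral_mul_const _ (by fun_prop)

lemma measurable_indicator_apply {α : Type*} [MeasurableSpace α] {s : Set ℝ}
    (hs : MeasurableSet s) {h : ℝ → α → ℝ≥0∞} {r : α → ℝ}
    (hh : Measurable fun p : ℝ × α ↦ h p.1 p.2) (hr : Measurable r) :
    Measurable fun a ↦ s.indicator (fun t ↦ h t a) (r a) :=
  Measurable.indicator (f := fun a ↦ h (r a) a) (hh.comp (hr.prodMk measurable_id)) (hr hs)

lemma lintegral_Ioc_sqrt_pow_ne_zero (d : ℕ) :
    ∫⁻ t in Set.Ioc (0 : ℝ) 1, ENNReal.ofReal (√t ^ d) ≠ 0 := by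
  refine ((setLIntegral_pos_iff (by fun_prop)).2 ?_).ne'
  refine lt_of_lt_of_le (by simp : 0 < volume (Set.Ioc (0 : ℝ) 1))
    (measure_mono fun t ht ↦ ⟨?_, ht⟩)
  exact (ENNReal.ofReal_pos.2 (pow_pos (Real.sqrt_pos.2 ht.1) d)).ne'

lemma lintegral_Ioc_sqrt_pow_ne_top (d : ℕ) :
    ∫⁻ t in Set.Ioc (0 : ℝ) 1, ENNReal.ofReal (√t ^ d) ≠ ∞ := by
  refine ne_top_of_le_ne_top (b := ∫⁻ _ in Set.Ioc (0 : ℝ) 1, 1) (by simp) ?_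
  refine setLIntegral_mono measurable_const fun t ht ↦ ?_
  exact ENNReal.ofReal_le_one.2 (pow_le_one₀ (Real.sqrt_nonneg t) (Real.sqrt_le_one.2 ht.2))

section

variable {V : Type*} [NormedAddCommGroup V]

/-- The point of the unit sphere of `V × ℝ²` with first component `y` and second component in the
direction of `w`. -/
noncomputable def sphereLift (p : V × EuclideanSpace ℝ (Fin 2)) :
    WithLp 2 (V × EuclideanSpace ℝ (Fin 2)) :=
  WithLp.toLp 2 (p.1, √(1 - ‖p.1‖ ^ 2) • p.2)

lemma norm_sphereLift {p : V × EuclideanSpace ℝ (Fin 2)} (h1 : ‖p.1‖ ≤ 1) (h2 : ‖p.2‖ = 1) :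
    ‖sphereLift p‖ = 1 := by
  rw [← sq_eq_sq₀ (norm_nonneg _) zero_le_one, WithLp.prod_norm_sq_eq_of_L2]
  have : 0 ≤ 1 - ‖p.1‖ ^ 2 := by nlinarith [norm_nonneg p.1]
  simp [sphereLift, norm_smul, h2, Real.sq_sqrt this]

variable [MeasurableSpace V] [BorelSpace V]

lemma measurable_sphereLift : Measurable (sphereLift (V := V)) :=
  (WithLp.measurable_toLp 2 _).comp (by fun_prop)

variable [InnerProductSpace ℝ V] [FiniteDimensional ℝ V]

/-- Integrating a function of the direction over the unit ball of `V × ℝ²` amounts, up to a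
constant, to integrating its lift over the product of the unit ball of `V` and the circle. -/
lemma lintegral_indicator_inv_norm_smul {κ : Measure (EuclideanSpace ℝ (Fin 2))}
    (hκ : IsUniformSphere κ) {f : WithLp 2 (V × EuclideanSpace ℝ (Fin 2)) → ℝ≥0∞}
    (hf : Measurable f) :
    ∫⁻ z, (Set.Ioc (0 : ℝ) 1).indicator (fun t ↦ f ((√t)⁻¹ • z)) (‖z‖ ^ 2) =
      ENNReal.ofReal Real.pi * ((∫⁻ t in Set.Ioc (0 : ℝ) 1,
        ENNReal.ofReal (√t ^ Module.finrank ℝ V)) *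
        ∫⁻ p, f (sphereLift p) ∂((volume.restrict (closedBall (0 : V) 1)).prod κ)) := by
  have := hκ.1
  have hlift : Measurable fun p : V × EuclideanSpace ℝ (Fin 2) ↦ f (sphereLift p) :=
    hf.comp measurable_sphereLift
  have hball : Measurable fun z : WithLp 2 (V × EuclideanSpace ℝ (Fin 2)) ↦
      (Set.Ioc (0 : ℝ) 1).indicator (fun t ↦ f ((√t)⁻¹ • z)) (‖z‖ ^ 2) :=
    measurable_indicator_apply measurableSet_Ioc (by fun_prop) (by fun_prop)
  calc ∫⁻ z, (Set.Ioc (0 : ℝ) 1).indicator (fun t ↦ f ((√t)⁻¹ • z)) (‖z‖ ^ 2)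
      = ∫⁻ y : V, ∫⁻ z : EuclideanSpace ℝ (Fin 2), (Set.Ioc (0 : ℝ) 1).indicator
          (fun t ↦ f ((√t)⁻¹ • WithLp.toLp 2 (y, z))) (‖y‖ ^ 2 + ‖z‖ ^ 2) := by
        rw [← (WithLp.volume_preserving_toLp V (EuclideanSpace ℝ (Fin 2))).lintegral_comp
          hball, Measure.volume_eq_prod, lintegral_prod]
        · simp_rw [WithLp.prod_norm_sq_eq_of_L2]
          rfl
        · exact (hball.comp (WithLp.measurable_toLp 2 _)).aemeasurable
    _ = ∫⁻ y : V, ENNReal.ofReal Real.pi * ∫⁻ s in Set.Ici (0 : ℝ), ∫⁻ w,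
          (Set.Ioc (0 : ℝ) 1).indicator
            (fun t ↦ f (sphereLift ((√t)⁻¹ • y, w))) (‖y‖ ^ 2 + s) ∂κ := by
        refine lintegral_congr fun y ↦ ?_
        have hy : Measurable fun z : EuclideanSpace ℝ (Fin 2) ↦ (Set.Ioc (0 : ℝ) 1).indicator
            (fun t ↦ f ((√t)⁻¹ • WithLp.toLp 2 (y, z))) (‖y‖ ^ 2 + ‖z‖ ^ 2) :=
          measurable_indicator_apply measurableSet_Ioc (by fun_prop) (by fun_prop)
        rw [hκ.lintegral_eq_lintegral_sqrt_smul hy]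
        congr 1
        refine setLIntegral_congr_fun measurableSet_Ici fun s hs ↦ lintegral_congr_ae ?_
        filter_upwards [hκ.ae_norm_eq_one] with w hw
        have hs : 0 ≤ s := hs
        rw [norm_smul, hw, mul_one, Real.norm_of_nonneg (Real.sqrt_nonneg s), Real.sq_sqrt hs]
        by_cases ht : ‖y‖ ^ 2 + s ∈ Set.Ioc (0 : ℝ) 1
        · have ht0 := ht.1
          rw [Set.indicator_of_mem ht, Set.indicator_of_mem ht, sphereLift, ← WithLp.toLp_smul,
            Prod.smul_mk, smul_smul]
          have : 1 - ‖(√(‖y‖ ^ 2 + s))⁻¹ • y‖ ^ 2 = s / (‖y‖ ^ 2 + s) := by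
            rw [norm_smul, mul_pow, norm_inv, inv_pow, Real.norm_of_nonneg (Real.sqrt_nonneg _),
              Real.sq_sqrt ht0.le]
            field_simp
            ring
          rw [this, Real.sqrt_div hs, div_eq_inv_mul]
        · rw [Set.indicator_of_notMem ht, Set.indicator_of_notMem ht]
    _ = ENNReal.ofReal Real.pi * ∫⁻ w, (∫⁻ y : V, ∫⁻ s in Set.Ici (0 : ℝ),
          (Set.Ioc (0 : ℝ) 1).indicator
            (fun t ↦ f (sphereLift ((√t)⁻¹ • y, w))) (‖y‖ ^ 2 + s)) ∂κ := by
        have hm : Measurable fun q : (V × ℝ) × EuclideanSpace ℝ (Fin 2) ↦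
            (Set.Ioc (0 : ℝ) 1).indicator
              (fun t ↦ f (sphereLift ((√t)⁻¹ • q.1.1, q.2))) (‖q.1.1‖ ^ 2 + q.1.2) :=
          measurable_indicator_apply measurableSet_Ioc (hlift.comp (by fun_prop)) (by fun_prop)
        have hm' : Measurable fun q : V × EuclideanSpace ℝ (Fin 2) ↦ ∫⁻ s in Set.Ici (0 : ℝ),
            (Set.Ioc (0 : ℝ) 1).indicator
              (fun t ↦ f (sphereLift ((√t)⁻¹ • q.1, q.2))) (‖q.1‖ ^ 2 + s) :=
          (hm.comp (f := fun q : (V × EuclideanSpace ℝ (Fin 2)) × ℝ ↦ ((q.1.1, q.2), q.1.2))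
            (by fun_prop)).lintegral_prod_right'
        rw [lintegral_const_mul]
        · congr 1
          refine Eq.trans (lintegral_congr fun y ↦ lintegral_lintegral_swap ?_)
            (lintegral_lintegral_swap hm'.aemeasurable)
          exact (hm.comp (f := fun q : ℝ × EuclideanSpace ℝ (Fin 2) ↦ ((y, q.1), q.2))
            (by fun_prop)).aemeasurable
        · exact (hm.lintegral_prod_right'.comp measurable_id).lintegral_prod_right'
    _ = _ := by
        congr 1
        rw [lintegral_prod_symm' _ hlift, ← lintegral_const_mul _ hlift.lintegral_prod_left']
        refine lintegral_congr fun w ↦ ?_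
        exact lintegral_lintegral_indicator_Ioc_norm_sq_add
          (hlift.comp (f := fun y ↦ (y, w)) (by fun_prop))

/-- If `y` is uniform on the unit ball of `V` and `w` is an independent uniform point of the
circle, then the lift of `(y, w)` is uniform on the unit sphere of `V × ℝ²`. -/
lemma isUniformSphere_map_sphereLift {κ : Measure (EuclideanSpace ℝ (Fin 2))}
    (hκ : IsUniformSphere κ) :
    IsUniformSphere ((((volume (closedBall (0 : V) 1))⁻¹ •
      volume.restrict (closedBall (0 : V) 1)).prod κ).map sphereLift) := by
  have := hκ.1
  have hD0 : volume (closedBall (0 : V) 1) ≠ 0 := (measure_closedBall_pos _ _ one_pos).ne'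
  have hDtop : volume (closedBall (0 : V) 1) ≠ ∞ := measure_closedBall_lt_top.ne
  have hball : IsProbabilityMeasure ((volume (closedBall (0 : V) 1))⁻¹ •
      volume.restrict (closedBall (0 : V) 1)) :=
    ⟨by simp [ENNReal.inv_mul_cancel hD0 hDtop]⟩
  refine ⟨Measure.isProbabilityMeasure_map measurable_sphereLift.aemeasurable, ?_, fun e ↦ ?_⟩
  · rw [Measure.map_apply measurable_sphereLift isClosed_sphere.measurableSet.compl,
      measure_eq_zero_iff_ae_notMem]
    have hy : ∀ᵐ y ∂((volume (closedBall (0 : V) 1))⁻¹ • volume.restrict (closedBall (0 : V) 1)),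
        ‖y‖ ≤ 1 := by
      refine Measure.ae_smul_measure ?_ _
      filter_upwards [ae_restrict_mem isClosed_closedBall.measurableSet] with y hy
      simpa using hy
    filter_upwards [Measure.quasiMeasurePreserving_fst.ae hy,
      Measure.quasiMeasurePreserving_snd.ae hκ.ae_norm_eq_one] with p h1 h2
    simpa using norm_sphereLift h1 h2
  · have he : Measurable e := e.continuous.measurable
    refine Measure.ext_of_lintegral _ fun f hf ↦ ?_
    have hfe : Measurable fun z ↦ f (e z) := hf.comp he
    have hinv : ∫⁻ z, (Set.Ioc (0 : ℝ) 1).indicator (fun t ↦ f (e ((√t)⁻¹ • z))) (‖z‖ ^ 2) =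
        ∫⁻ z, (Set.Ioc (0 : ℝ) 1).indicator (fun t ↦ f ((√t)⁻¹ • z)) (‖z‖ ^ 2) := by
      have hm : Measurable fun z ↦
          (Set.Ioc (0 : ℝ) 1).indicator (fun t ↦ f ((√t)⁻¹ • z)) (‖z‖ ^ 2) :=
        measurable_indicator_apply measurableSet_Ioc (by fun_prop) (by fun_prop)
      rw [← e.measurePreserving.lintegral_comp hm]
      simp_rw [e.norm_map, map_smul]
    rw [lintegral_indicator_inv_norm_smul hκ hfe, lintegral_indicator_inv_norm_smul hκ hf,
      ENNReal.mul_right_inj (by simp [Real.pi_pos]) ENNReal.ofReal_ne_top,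
      ENNReal.mul_right_inj (lintegral_Ioc_sqrt_pow_ne_zero _)
        (lintegral_Ioc_sqrt_pow_ne_top _)] at hinv
    rw [lintegral_map hf he, lintegral_map hfe measurable_sphereLift,
      lintegral_map hf measurable_sphereLift, Measure.prod_smul_left, lintegral_smul_measure,
      lintegral_smul_measure, hinv]

end

/-- Concatenation of coordinates, as a linear isometry. -/
noncomputable def euclideanAppend (m k : ℕ) :
    WithLp 2 (EuclideanSpace ℝ (Fin m) × EuclideanSpace ℝ (Fin k)) ≃ₗᵢ[ℝ]
      EuclideanSpace ℝ (Fin (m + k)) :=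
  (PiLp.sumPiLpEquivProdLpPiLp 2 (fun _ : Fin m ⊕ Fin k ↦ ℝ)).symm.trans
    (LinearIsometryEquiv.piLpCongrLeft 2 ℝ ℝ finSumFinEquiv)

lemma euclideanAppend_apply {m k : ℕ} (y : EuclideanSpace ℝ (Fin m))
    (w : EuclideanSpace ℝ (Fin k)) (j : Fin (m + k)) :
    euclideanAppend m k (WithLp.toLp 2 (y, w)) j =
      if h : (j : ℕ) < m then y ⟨j, h⟩ else w ⟨(j : ℕ) - m, by have := j.isLt; omega⟩ := by
  refine Fin.addCases (fun i ↦ ?_) (fun i ↦ ?_) j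
  · simp [euclideanAppend, LinearIsometryEquiv.piLpCongrLeft_apply, Equiv.piCongrLeft']
  · simp [euclideanAppend, LinearIsometryEquiv.piLpCongrLeft_apply, Equiv.piCongrLeft']

/-- conditional distribution on the sphere given the first `n − 2`
coordinates.  First part: for a fixed `x ∈ ℝ^{n-2}` with `x₁² + ⋯ + x_{n-2}² < 1`,
the map `(u,v) ↦ (x₁, …, x_{n-2}, ρu, ρv)` with `ρ = √(1 − x₁² − ⋯ − x_{n-2}²)`
pushes the uniform measure on `S¹` to the uniform measure on the circle
`{z ∈ S^{n-1} : zᵢ = xᵢ for i ≤ n−2}` — i.e. to a probability measure concentrated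
on that circle and invariant under every rotation of the last two coordinates.
Second part: consequently, if `Y` is uniform on the unit ball of `ℝ^{n-2}` and
`(u, v)` is an independent uniform point of `S¹`, then
`(Y₁, …, Y_{n-2}, u·√(1−‖Y‖²), v·√(1−‖Y‖²))` is uniform on `S^{n-1} ⊂ ℝⁿ`. -/
theorem sphere_conditional_on_first_coords
    {Ω : Type*} [MeasureSpace Ω] [IsProbabilityMeasure (ℙ : Measure Ω)]
    (n : ℕ) (hn : 3 ≤ n)
    -- data for the first part: a fixed point strictly inside the unit ball of ℝ^{n-2}
    (x : EuclideanSpace ℝ (Fin (n - 2))) (hx : ∑ i, x i ^ 2 < 1)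
    (F : EuclideanSpace ℝ (Fin 2) → EuclideanSpace ℝ (Fin n))
    (hF : ∀ (w : EuclideanSpace ℝ (Fin 2)) (j : Fin n),
      F w j = if h : (j : ℕ) < n - 2 then x ⟨j, h⟩
        else Real.sqrt (1 - ∑ i, x i ^ 2) * w ⟨(j : ℕ) - (n - 2), by have := j.isLt; omega⟩)
    (μcirc : Measure (EuclideanSpace ℝ (Fin 2))) (hμcirc : IsUniformSphere μcirc)
    -- data for the second part: a uniform point of the ball and an independent
    -- uniform point of the circle
    (Y : Ω → EuclideanSpace ℝ (Fin (n - 2))) (hYmeas : Measurable Y)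
    (hY : Measure.map Y ℙ = uniformBall (n - 2))
    (w : Ω → EuclideanSpace ℝ (Fin 2)) (hwmeas : Measurable w)
    (hw : IsUniformSphere (Measure.map w ℙ))
    (hindep : IndepFun Y w ℙ)
    (Z : Ω → EuclideanSpace ℝ (Fin n))
    (hZ : ∀ ω (j : Fin n),
      Z ω j = if h : (j : ℕ) < n - 2 then Y ω ⟨j, h⟩
        else Real.sqrt (1 - ‖Y ω‖ ^ 2) * w ω ⟨(j : ℕ) - (n - 2), by have := j.isLt; omega⟩) :
    -- first part: `F` pushes the uniform measure on `S¹` to the uniform measure on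
    -- the circle `{z ∈ S^{n-1} : zᵢ = xᵢ for i ≤ n−2}`
    (IsProbabilityMeasure (μcirc.map F) ∧
      μcirc.map F {z : EuclideanSpace ℝ (Fin n) |
          ‖z‖ = 1 ∧ ∀ (i : Fin n) (h : (i : ℕ) < n - 2), z i = x ⟨i, h⟩}ᶜ = 0 ∧
      ∀ (e : EuclideanSpace ℝ (Fin 2) ≃ₗᵢ[ℝ] EuclideanSpace ℝ (Fin 2))
        (R : EuclideanSpace ℝ (Fin n) → EuclideanSpace ℝ (Fin n)),
        (∀ (z : EuclideanSpace ℝ (Fin n)) (j : Fin n),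
          R z j = if h : (j : ℕ) < n - 2 then z j
            else e ((WithLp.equiv 2 (Fin 2 → ℝ)).symm
                (fun k : Fin 2 => z ⟨n - 2 + (k : ℕ), by have := k.isLt; omega⟩))
              ⟨(j : ℕ) - (n - 2), by have := j.isLt; omega⟩) →
        (μcirc.map F).map R = μcirc.map F) ∧
    -- second part: the combined random vector is uniform on `S^{n-1}`
    IsUniformSphere (Measure.map Z ℙ) := by
  obtain ⟨m, rfl⟩ : ∃ m, n = m + 2 := ⟨n - 2, by omega⟩
  change EuclideanSpace ℝ (Fin m) at x
  change Ω → EuclideanSpace ℝ (Fin m) at Y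
  change Measure.map Y ℙ = uniformBall m at hY
  have hJ : ∀ (y : EuclideanSpace ℝ (Fin m)) (v : EuclideanSpace ℝ (Fin 2)) (j : Fin (m + 2)),
      euclideanAppend m 2 (WithLp.toLp 2 (y, v)) j = if h : (j : ℕ) < m + 2 - 2 then y ⟨j, h⟩
        else v ⟨(j : ℕ) - (m + 2 - 2), by have := j.isLt; omega⟩ := euclideanAppend_apply
  have hJm : Measurable (euclideanAppend m 2) := (euclideanAppend m 2).continuous.measurable
  constructor
  · have hxnorm : ‖x‖ ^ 2 = ∑ i, x i ^ 2 := EuclideanSpace.real_norm_sq_eq x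
    have hF' : F = fun v ↦ euclideanAppend m 2 (sphereLift (x, v)) := by
      ext v j
      rw [hF, sphereLift, hJ, hxnorm]
      rfl
    have hFm : Measurable F := by
      rw [hF']
      exact hJm.comp (measurable_sphereLift.comp (by fun_prop))
    have := hμcirc.1
    refine ⟨Measure.isProbabilityMeasure_map hFm.aemeasurable, ?_, fun e R hR ↦ ?_⟩
    · have hS : MeasurableSet {z : EuclideanSpace ℝ (Fin (m + 2)) |
          ‖z‖ = 1 ∧ ∀ (i : Fin (m + 2)) (h : (i : ℕ) < m + 2 - 2), z i = x ⟨i, h⟩} := by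
        simp only [Set.ofPred_and, Set.ofPred_forall]
        exact (measurableSet_eq_fun measurable_norm measurable_const).inter
          (MeasurableSet.iInter fun i ↦ MeasurableSet.iInter fun h ↦
            measurableSet_eq_fun (by fun_prop) measurable_const)
      rw [Measure.map_apply hFm hS.compl, measure_eq_zero_iff_ae_notMem]
      filter_upwards [hμcirc.ae_norm_eq_one] with v hv
      have hx1 : ‖x‖ ≤ 1 := (sq_le_one_iff₀ (norm_nonneg x)).1 (hxnorm ▸ hx.le)
      simp only [Set.mem_preimage, Set.mem_compl_iff, not_not]
      refine ⟨?_, fun i h ↦ ?_⟩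
      · rw [hF', LinearIsometryEquiv.norm_map]
        exact norm_sphereLift hx1 hv
      · rw [hF, dif_pos h]
    · have hR' : R = fun z ↦ euclideanAppend m 2 (WithLp.toLp 2
          (WithLp.toLp 2 (fun i : Fin m ↦ z (Fin.castAdd 2 i)),
            e (WithLp.toLp 2 (fun k : Fin 2 ↦ z (Fin.natAdd m k))))) := by
        ext z j
        rw [hR, hJ]
        rfl
      have hRm : Measurable R := by
        rw [hR']
        fun_prop
      have hcomp : R ∘ F = F ∘ e := by
        ext v j
        simp only [Function.comp_apply, hR]
        by_cases h : (j : ℕ) < m + 2 - 2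
        · simp only [hF, dif_pos h]
        · have hlast : (fun k : Fin 2 ↦ F v ⟨m + 2 - 2 + (k : ℕ), by omega⟩) =
              √(1 - ∑ i, x i ^ 2) • v.ofLp := by
            ext k
            refine (hF v _).trans ((dif_neg (by simp)).trans ?_)
            simp only [add_tsub_cancel_left]
            rfl
          simp only [dif_neg h, hlast, hF (e v)]
          have := map_smul e (√(1 - ∑ i, x i ^ 2)) v
          exact congrArg (fun u : EuclideanSpace ℝ (Fin 2) ↦ u _) this
      rw [Measure.map_map hRm hFm, hcomp, ← Measure.map_map hFm e.continuous.measurable,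
        hμcirc.2.2 e]
  · have hZ' : Z = fun ω ↦ euclideanAppend m 2 (sphereLift (Y ω, w ω)) := by
      ext ω j
      rw [hZ, sphereLift, hJ]
      rfl
    have hmap : Measure.map Z ℙ = (((uniformBall m).prod (Measure.map w ℙ)).map sphereLift).map
        (euclideanAppend m 2) := by
      rw [← hY, ← (indepFun_iff_map_prod_eq_prod_map_map hYmeas.aemeasurable
        hwmeas.aemeasurable).1 hindep, Measure.map_map hJm measurable_sphereLift,
        Measure.map_map (hJm.comp measurable_sphereLift) (hYmeas.prodMk hwmeas), hZ']
      rfl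
    rw [hmap]
    exact (isUniformSphere_map_sphereLift hw).map _
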